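/- Let d, M, T ≥ 1 and 1 ≤ t ≤ T, and let P ∈ ℝ^{(d+1)×(T(M+1)+1)} be a prompt whose first T(M+1) columns consist, for each task s = 1,…,T in order, of M example columns (x_{s,j}; y_{s,j}) followed by a query column with label 0, and whose final column is (x_{t,q}; 0). Consider masked linear self-attention f_MSA(P) = P + W* P · mask(P^T V* P), where [mask(A)]_{i,j} = A_{i,j}/j for i ≤ j and 0 for i > j, W* = a^{1/4}·[[0_{d×d}, 0_d],[0_d^T, 1]], V* = a^{−1/4}·[[Γ^{−1}, 0_d],[0_d^T, 0]] for any a > 0. Then the (d+1)-st coordinate of the final column of f_MSA(P) equals Ŷ_{t,q} = x_{t,q}^T Γ^{−1} ( (1/(T(M+1)+1)) Σ_{s=1}^T Σ_{j=1}^M x_{s,j} y_{s,j} ). -/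

import Mathlib

open Matrix BigOperators

/-- The decoder mask: `[mask A]_{i,j} = A_{i,j}/j` for `i ≤ j` (1-indexed `j`, i.e.
`(j+1)` for 0-indexed `Fin` columns) and `0` for `i > j`. -/
noncomputable def maskMat {n : ℕ} (A : Matrix (Fin n) (Fin n) ℝ) : Matrix (Fin n) (Fin n) ℝ :=
  Matrix.of fun i j => if (i : ℕ) ≤ (j : ℕ) then A i j / ((j : ℕ) + 1) else 0

/-- The column index (0-based) of the `j`-th column of the task-`s` block, where each
task block consists of `M` example columns followed by one query column. -/
def colIdx (M T n : ℕ) (h : T * (M + 1) ≤ n) (s : Fin T) (j : Fin (M + 1)) : Fin n :=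
  ⟨(s : ℕ) * (M + 1) + (j : ℕ), by
    calc (s : ℕ) * (M + 1) + (j : ℕ)
        < (s : ℕ) * (M + 1) + (M + 1) := Nat.add_lt_add_left j.isLt _
      _ = ((s : ℕ) + 1) * (M + 1) := by ring
      _ ≤ T * (M + 1) := Nat.mul_le_mul_right _ s.isLt
      _ ≤ n := h⟩

theorem sum_univ_eq_sum_colIdx_add_last {β : Type*} [AddCommMonoid β] (M T : ℕ)
    (f : Fin (T * (M + 1) + 1) → β) :
    ∑ i, f i = (∑ s : Fin T, ∑ j : Fin (M + 1), f (colIdx M T _ (Nat.le_succ _) s j))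
      + f (Fin.last (T * (M + 1))) := by
  rw [Fin.sum_univ_castSucc, ← finProdFinEquiv.sum_comp, Fintype.sum_prod_type]
  congr 1
  refine Finset.sum_congr rfl fun s _ => Finset.sum_congr rfl fun j _ => congrArg f ?_
  ext
  simp [colIdx, finProdFinEquiv]
  ring

theorem transpose_mul_fromBlocks_mul_apply {d n : ℕ} (G : Matrix (Fin d) (Fin d) ℝ)
    (P : Matrix (Fin d ⊕ Unit) (Fin n) ℝ) (i j : Fin n) :
    (Pᵀ * fromBlocks G 0 0 (0 : Matrix Unit Unit ℝ) * P) i j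
      = (fun k => P (Sum.inl k) i) ⬝ᵥ (G *ᵥ fun k => P (Sum.inl k) j) := by
  rw [Matrix.mul_assoc]
  simp [Matrix.mul_apply, dotProduct, mulVec]

theorem fromBlocks_mul_apply_inr {d n : ℕ} (P : Matrix (Fin d ⊕ Unit) (Fin n) ℝ) (i : Fin n) :
    (fromBlocks (0 : Matrix (Fin d) (Fin d) ℝ) 0 0 (1 : Matrix Unit Unit ℝ) * P) (Sum.inr ()) i
      = P (Sum.inr ()) i := by
  simp [Matrix.mul_apply]

theorem Matrix.IsSymm.dotProduct_mulVec_comm {d : ℕ} {G : Matrix (Fin d) (Fin d) ℝ}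
    (hG : G.IsSymm) (u v : Fin d → ℝ) : u ⬝ᵥ (G *ᵥ v) = v ⬝ᵥ (G *ᵥ u) := by
  rw [dotProduct_mulVec, ← mulVec_transpose, hG.eq, dotProduct_comm]

/-- for masked linear self-attention applied to the full `T`-task prompt of
`T(M+1)+1` columns (for each task `s = 1,…,T` in order, `M` example columns
`(x_{s,j}; y_{s,j})` followed by a query column with label `0`, and a final column
`(x_{t,q}; 0)`), the label coordinate of the final column equals
`Ŷ_{t,q} = x_{t,q}ᵀ Γ⁻¹ ((1/(T(M+1)+1)) Σ_{s=1}^T Σ_{j=1}^M x_{s,j} y_{s,j})`. -/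
theorem stmt_8 (d M T t : ℕ) (hd : 1 ≤ d) (hM : 1 ≤ M) (hT : 1 ≤ T)
    (ht1 : 1 ≤ t) (htT : t ≤ T)
    (N : ℝ) (hN : 0 < N)
    (Λ : Matrix (Fin d) (Fin d) ℝ) (hΛsym : Λ.IsSymm) (hΛpd : Λ.PosDef)
    (Γ : Matrix (Fin d) (Fin d) ℝ)
    (hΓ : Γ = (1 + 1 / N) • Λ + (Λ.trace / N) • (1 : Matrix (Fin d) (Fin d) ℝ))
    (a : ℝ) (ha : 0 < a)
    (x : Fin T → Fin M → Fin d → ℝ) (y : Fin T → Fin M → ℝ)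
    (xsq : Fin T → Fin d → ℝ) (xq : Fin d → ℝ)
    (P : Matrix (Fin d ⊕ Unit) (Fin (T * (M + 1) + 1)) ℝ)
    (hPex : ∀ (s : Fin T) (j : Fin M),
        (∀ k, P (Sum.inl k) (colIdx M T _ (Nat.le_succ _) s j.castSucc) = x s j k)
          ∧ P (Sum.inr ()) (colIdx M T _ (Nat.le_succ _) s j.castSucc) = y s j)
    (hPq : ∀ s : Fin T,
        (∀ k, P (Sum.inl k) (colIdx M T _ (Nat.le_succ _) s (Fin.last M)) = xsq s k)
          ∧ P (Sum.inr ()) (colIdx M T _ (Nat.le_succ _) s (Fin.last M)) = 0)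
    (hPfin : (∀ k, P (Sum.inl k) (Fin.last (T * (M + 1))) = xq k)
        ∧ P (Sum.inr ()) (Fin.last (T * (M + 1))) = 0)
    (Wstar Vstar : Matrix (Fin d ⊕ Unit) (Fin d ⊕ Unit) ℝ)
    (hW : Wstar = a ^ ((1 : ℝ) / 4) •
        fromBlocks (0 : Matrix (Fin d) (Fin d) ℝ) 0 0 (1 : Matrix Unit Unit ℝ))
    (hV : Vstar = a ^ (-(1 : ℝ) / 4) •
        fromBlocks Γ⁻¹ 0 0 (0 : Matrix Unit Unit ℝ))
    (out : Matrix (Fin d ⊕ Unit) (Fin (T * (M + 1) + 1)) ℝ)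
    (hout : out = P + Wstar * P * maskMat (Pᵀ * Vstar * P)) :
    out (Sum.inr ()) (Fin.last (T * (M + 1)))
      = xq ⬝ᵥ (Γ⁻¹ *ᵥ ((1 / ((T : ℝ) * ((M : ℝ) + 1) + 1)) • ∑ s, ∑ j, y s j • x s j)) := by
  have hΓsymm : Γ⁻¹.IsSymm := by
    have hsymm : Γ.IsSymm := by
      rw [hΓ]
      exact (hΛsym.smul _).add (isSymm_one.smul _)
    rw [IsSymm, transpose_nonsing_inv, hsymm.eq]
  have hc : a ^ ((1 : ℝ) / 4) * a ^ (-(1 : ℝ) / 4) = 1 := by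
    rw [← Real.rpow_add ha]
    norm_num
  have hWP : ∀ i, (Wstar * P) (Sum.inr ()) i = a ^ ((1 : ℝ) / 4) * P (Sum.inr ()) i := by
    intro i
    rw [hW, Matrix.smul_mul, Matrix.smul_apply, fromBlocks_mul_apply_inr, smul_eq_mul]
  have hlast : (fun k => P (Sum.inl k) (Fin.last (T * (M + 1)))) = xq := funext hPfin.1
  have hmask : ∀ i, maskMat (Pᵀ * Vstar * P) i (Fin.last (T * (M + 1)))
      = a ^ (-(1 : ℝ) / 4) * (xq ⬝ᵥ (Γ⁻¹ *ᵥ fun k => P (Sum.inl k) i))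
        / ((T : ℝ) * ((M : ℝ) + 1) + 1) := by
    intro i
    have hle : (i : ℕ) ≤ (Fin.last (T * (M + 1)) : ℕ) := Fin.le_last i
    rw [maskMat, of_apply, if_pos hle, hV, Matrix.mul_smul, Matrix.smul_mul, Matrix.smul_apply,
      transpose_mul_fromBlocks_mul_apply, hlast, hΓsymm.dotProduct_mulVec_comm, smul_eq_mul,
      Fin.val_last]
    push_cast
    rfl
  have hterm : ∀ i, (Wstar * P) (Sum.inr ()) i
        * maskMat (Pᵀ * Vstar * P) i (Fin.last (T * (M + 1)))
      = 1 / ((T : ℝ) * ((M : ℝ) + 1) + 1)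
        * (P (Sum.inr ()) i * (xq ⬝ᵥ (Γ⁻¹ *ᵥ fun k => P (Sum.inl k) i))) := by
    intro i
    rw [hWP, hmask]
    linear_combination (P (Sum.inr ()) i * (xq ⬝ᵥ (Γ⁻¹ *ᵥ fun k => P (Sum.inl k) i))
      / ((T : ℝ) * ((M : ℝ) + 1) + 1)) * hc
  have hx : ∀ s j, (fun k => P (Sum.inl k) (colIdx M T _ (Nat.le_succ _) s (Fin.castSucc j)))
      = x s j := fun s j => funext (hPex s j).1
  rw [hout, Matrix.add_apply, hPfin.2, zero_add, Matrix.mul_apply,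
    Finset.sum_congr rfl fun i _ => hterm i, ← Finset.mul_sum,
    sum_univ_eq_sum_colIdx_add_last, hPfin.2, zero_mul, add_zero, mulVec_smul, dotProduct_smul,
    smul_eq_mul]
  simp only [Fin.sum_univ_castSucc, (hPq _).2, zero_mul, add_zero, (hPex _ _).2, hx,
    mulVec_sum, dotProduct_sum, mulVec_smul, dotProduct_smul, smul_eq_mul]
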